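/- Let f : ℝⁿ → ℝ be twice continuously differentiable at x̄ with f(x̄) = 0, and let C = {x : f(x) ≤ 0}. Assume ∇f(x̄) ≠ 0. Then C has the second order supporting hyperplane (SOSH) property at x̄: there exist δ > 0 and M > 0 such that for all x ∈ B(x̄, δ) ∩ C with f(x) = 0 and all unit normals v ∈ N_C(x), ⟨v, x - x̄⟩ ≤ M ‖x - x̄‖². -/

import Mathlib

open scoped RealInnerProductSpace
open Metric Filter

/-- The regular (Fréchet) normal cone of `C` at `x`. -/
def regNormalCone {n : ℕ} (C : Set (EuclideanSpace ℝ (Fin n)))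
    (x : EuclideanSpace ℝ (Fin n)) : Set (EuclideanSpace ℝ (Fin n)) :=
  {v | ∀ ε > 0, ∃ δ > 0, ∀ y ∈ C, ‖y - x‖ < δ → ⟪v, y - x⟫ ≤ ε * ‖y - x‖}

/-- The limiting normal cone of `C` at `x`: limits of regular normals at points of `C`
converging to `x`. -/
def limNormalCone {n : ℕ} (C : Set (EuclideanSpace ℝ (Fin n)))
    (x : EuclideanSpace ℝ (Fin n)) : Set (EuclideanSpace ℝ (Fin n)) :=
  {v | ∃ xs vs : ℕ → EuclideanSpace ℝ (Fin n), (∀ i, xs i ∈ C) ∧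
    Tendsto xs atTop (nhds x) ∧ (∀ i, vs i ∈ regNormalCone C (xs i)) ∧
    Tendsto vs atTop (nhds v)}

open scoped Topology in
/-- If `f` has negative directional derivative at `x` along `w`, then `w` makes a nonpositive
inner product with every regular normal to the sublevel set at `x`. -/
theorem inner_nonpos_of_mem_regNormalCone {n : ℕ} {f : EuclideanSpace ℝ (Fin n) → ℝ}
    {x v w : EuclideanSpace ℝ (Fin n)} (hf : DifferentiableAt ℝ f x) (hx : f x ≤ 0)
    (hv : v ∈ regNormalCone {y | f y ≤ 0} x) (hw : ⟪gradient f x, w⟫ < 0) :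
    ⟪v, w⟫ ≤ 0 := by
  have hderiv : HasDerivAt (fun t : ℝ => f (x + t • w)) ⟪gradient f x, w⟫ 0 := by
    have hline : HasDerivAt (fun t : ℝ => x + t • w) w 0 := by
      simpa using ((hasDerivAt_id (0 : ℝ)).smul_const w).const_add x
    have hfd : HasFDerivAt f (fderiv ℝ f x) (x + (0 : ℝ) • w) := by
      simpa using hf.hasFDerivAt
    simpa [gradient, Function.comp_def] using hfd.comp_hasDerivAt (0 : ℝ) hline
  have hmem : ∀ᶠ t in 𝓝[>] (0 : ℝ), f (x + t • w) ≤ 0 := by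
    have hslope := (hasDerivAt_iff_tendsto_slope.1 hderiv).mono_left
      (nhdsWithin_mono 0 fun t (ht : 0 < t) => ne_of_gt ht)
    filter_upwards [hslope.eventually (gt_mem_nhds hw), self_mem_nhdsWithin] with t ht htpos
    have htpos : 0 < t := htpos
    rw [slope_def_field, div_lt_iff₀ (by simpa using htpos)] at ht
    simp only [zero_smul, add_zero, zero_mul] at ht
    linarith
  refine le_of_forall_pos_le_add fun η hη => ?_
  have hpos : 0 < ‖w‖ + 1 := by positivity
  obtain ⟨δ, hδ, H⟩ := hv (η / (‖w‖ + 1)) (by positivity)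
  have hsmall : ∀ᶠ t in 𝓝[>] (0 : ℝ), ‖t • w‖ < δ := by
    have hcont : Tendsto (fun t : ℝ => ‖t • w‖) (𝓝 0) (𝓝 0) := by
      have : Continuous fun t : ℝ => ‖t • w‖ := by fun_prop
      simpa using this.tendsto 0
    exact nhdsWithin_le_nhds (hcont.eventually (gt_mem_nhds hδ))
  obtain ⟨t, ⟨htC, htδ⟩, ht⟩ := ((hmem.and hsmall).and self_mem_nhdsWithin).exists
  have ht : 0 < t := ht
  have h := H (x + t • w) htC (by simpa using htδ)
  rw [add_sub_cancel_left, inner_smul_right, norm_smul, Real.norm_of_nonneg ht.le,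
    mul_left_comm] at h
  have hle := le_of_mul_le_mul_left h ht
  have : η / (‖w‖ + 1) * ‖w‖ ≤ η := by
    rw [div_mul_eq_mul_div, div_le_iff₀ hpos]
    nlinarith
  linarith

/-- Vectors `v` with `⟪v, w⟫ ≤ 0` whenever `⟪g, w⟫ < 0` attain equality with `g` in the
Cauchy–Schwarz inequality. -/
theorem inner_eq_norm_mul_norm_of_forall_inner_nonpos {E : Type*} [NormedAddCommGroup E]
    [InnerProductSpace ℝ E] {g v : E} (h : ∀ w, ⟪g, w⟫ < 0 → ⟪v, w⟫ ≤ 0) :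
    ⟪v, g⟫ = ‖v‖ * ‖g‖ := by
  rcases eq_or_ne g 0 with rfl | hg
  · simp
  refine le_antisymm (real_inner_le_norm v g) (not_lt.1 fun hlt => ?_)
  have hgpos : 0 < ‖g‖ := norm_pos_iff.2 hg
  have hvpos : 0 < ‖v‖ := by
    rcases eq_or_ne v 0 with rfl | hv
    · simp at hlt
    · exact norm_pos_iff.2 hv
  -- `‖g‖ • v - ‖v‖ • g` bisects the angle between `v` and `-g`.
  have hgw : ⟪g, ‖g‖ • v - ‖v‖ • g⟫ < 0 := by
    rw [inner_sub_right, inner_smul_right, inner_smul_right, real_inner_self_eq_norm_sq,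
      real_inner_comm]
    nlinarith
  have hvw := h _ hgw
  rw [inner_sub_right, inner_smul_right, inner_smul_right, real_inner_self_eq_norm_sq] at hvw
  nlinarith

/-- A limiting normal to a sublevel set is a nonnegative multiple of the gradient, expressed as
equality in the Cauchy–Schwarz inequality. -/
theorem inner_gradient_eq_of_mem_limNormalCone {n : ℕ} {f : EuclideanSpace ℝ (Fin n) → ℝ}
    {x v : EuclideanSpace ℝ (Fin n)} (hf : ContDiffAt ℝ 1 f x)
    (hv : v ∈ limNormalCone {y | f y ≤ 0} x) :
    ⟪v, gradient f x⟫ = ‖v‖ * ‖gradient f x‖ := by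
  obtain ⟨xs, vs, hxs, hx, hvs, hv⟩ := hv
  have hcont : ContinuousAt (gradient f) x :=
    (InnerProductSpace.toDual ℝ _).symm.continuous.continuousAt.comp
      (hf.fderiv_right (m := 0) (by norm_num)).continuousAt
  have hg := hcont.tendsto.comp hx
  refine tendsto_nhds_unique_of_eventuallyEq (hv.inner hg) (hv.norm.mul hg.norm) ?_
  filter_upwards [hx.eventually (hf.eventually (by simp))] with i hi
  exact inner_eq_norm_mul_norm_of_forall_inner_nonpos fun w =>
    inner_nonpos_of_mem_regNormalCone (hi.differentiableAt (by simp)) (hxs i) (hvs i)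

/-- First-order Taylor estimate on a convex set where the derivative is Lipschitz. -/
theorem norm_sub_sub_fderiv_le_of_lipschitzOnWith {E F : Type*} [NormedAddCommGroup E]
    [NormedSpace ℝ E] [NormedAddCommGroup F] [NormedSpace ℝ F] {f : E → F} {s : Set E}
    {K : NNReal} (hs : Convex ℝ s) (hf : ∀ y ∈ s, DifferentiableAt ℝ f y)
    (hK : LipschitzOnWith K (fderiv ℝ f) s) {x y : E} (hx : x ∈ s) (hy : y ∈ s) :
    ‖f y - f x - fderiv ℝ f x (y - x)‖ ≤ K * ‖y - x‖ ^ 2 := by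
  have hseg : segment ℝ x y ⊆ s := hs.segment_subset hx hy
  have h := (convex_segment x y).norm_image_sub_le_of_norm_fderiv_le' (𝕜 := ℝ) (f := f)
    (φ := fderiv ℝ f x) (C := K * ‖y - x‖) (fun z hz => hf z (hseg hz))
    (fun z hz => (hK.norm_sub_le (hseg hz) hx).trans
      (mul_le_mul_of_nonneg_left (norm_sub_le_of_mem_segment hz) K.coe_nonneg))
    (left_mem_segment ℝ x y) (right_mem_segment ℝ x y)
  rwa [mul_assoc, ← sq] at h

/-- Smoothness implies SOSH: if `f` is `C²` at `x̄` with `f(x̄) = 0` and `∇f(x̄) ≠ 0`, then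
`C = {x : f(x) ≤ 0}` has the second order supporting hyperplane property at `x̄`. -/
theorem smooth_implies_SOSH {n : ℕ}
    (f : EuclideanSpace ℝ (Fin n) → ℝ) (xbar : EuclideanSpace ℝ (Fin n))
    (hf : ContDiffAt ℝ 2 f xbar) (hf0 : f xbar = 0) (hgrad : gradient f xbar ≠ 0) :
    ∃ δ > 0, ∃ M > 0, ∀ x ∈ closedBall xbar δ ∩ {y | f y ≤ 0}, f x = 0 →
      ∀ v ∈ limNormalCone {y | f y ≤ 0} x, ‖v‖ = 1 →
        ⟪v, x - xbar⟫ ≤ M * ‖x - xbar‖ ^ 2 := by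
  have hfd : ContDiffAt ℝ 1 (fderiv ℝ f) xbar := hf.fderiv_right (by norm_num)
  obtain ⟨K, s, hs, hK⟩ := hfd.exists_lipschitzOnWith
  have hcont : ContinuousAt (gradient f) xbar :=
    (InnerProductSpace.toDual ℝ _).symm.continuous.continuousAt.comp hfd.continuousAt
  have hgpos : 0 < ‖gradient f xbar‖ := norm_pos_iff.2 hgrad
  set c := ‖gradient f xbar‖ / 2
  have hcpos : 0 < c := half_pos hgpos
  have hlower : ∀ᶠ y in nhds xbar, c < ‖gradient f y‖ :=
    hcont.norm.eventually (lt_mem_nhds (half_lt_self hgpos))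
  obtain ⟨r, hr, hball⟩ := Metric.eventually_nhds_iff_ball.1
    ((hf.eventually (by simp)).and (hlower.and hs))
  refine ⟨r / 2, half_pos hr, K / c + 1, by positivity, ?_⟩
  rintro x ⟨hxball, -⟩ hfx v hv hv1
  have hxr : x ∈ ball xbar r := closedBall_subset_ball (half_lt_self hr) hxball
  obtain ⟨hfC, hgx, -⟩ := hball x hxr
  have htaylor := norm_sub_sub_fderiv_le_of_lipschitzOnWith (convex_ball xbar r)
    (fun y hy => (hball y hy).1.differentiableAt (by simp))
    (hK.mono fun y hy => (hball y hy).2.2) hxr (mem_ball_self hr)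
  have hinner : ⟪gradient f x, x - xbar⟫ ≤ K * ‖x - xbar‖ ^ 2 := by
    rw [hf0, hfx, sub_zero, zero_sub, ← map_neg, neg_sub, norm_sub_rev xbar x] at htaylor
    simpa [gradient] using (Real.le_norm_self _).trans htaylor
  have hvg : ‖gradient f x‖ • v = gradient f x := by
    have h := inner_eq_norm_mul_iff_real.1
      (inner_gradient_eq_of_mem_limNormalCone (hfC.of_le (by norm_num)) hv)
    rwa [hv1, one_smul] at h
  rw [← hvg, inner_smul_left, conj_trivial] at hinner
  have hsq : 0 ≤ ‖x - xbar‖ ^ 2 := sq_nonneg _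
  rcases le_total ⟪v, x - xbar⟫ 0 with hneg | hpos
  · exact hneg.trans (by positivity)
  · have hmul : c * ⟪v, x - xbar⟫ ≤ K * ‖x - xbar‖ ^ 2 :=
      (mul_le_mul_of_nonneg_right hgx.le hpos).trans hinner
    have hdiv : ⟪v, x - xbar⟫ ≤ K / c * ‖x - xbar‖ ^ 2 := by
      rw [div_mul_eq_mul_div, le_div_iff₀ hcpos]
      linarith
    linarith
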